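/- Let λ > 0, η > 0, 0 < β < 1 and T̲ > 0, and let g : ℝ → ℝ be bounded on [T̲, ∞). Define m : ℝ → ℝ by m(T) = λT²/2 + g(T) + β^T · ∑_{k=0}^{∞} e^{−λT} (λT)^k / k! · √(2η k(k+1)). Suppose c* ∈ ℝ satisfies c* = inf_{T ≥ T̲} ( m(T) + β^T c* ), and define v : ℕ → ℝ by v(x) = √(2η x(x+1)) + c*. Then for every x ∈ ℕ, v(x) = inf over a ∈ (0, ∞) and T ∈ [T̲, ∞) of { x(x+1)/(2a) + ηa + λT²/2 + β^T · ∑_{k=0}^{∞} e^{−λT} (λT)^k / k! · v(k) + g(T) }. -/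

import Mathlib

open Real

/-- The Poisson weights with parameter `r` sum to one. -/
theorem hasSum_poisson_weights (r : ℝ) :
    HasSum (fun k : ℕ => exp (-r) * r ^ k / (Nat.factorial k)) 1 := by
  have h := (NormedSpace.expSeries_div_hasSum_exp (𝔸 := ℝ) r).mul_left (exp (-r))
  rw [← congrFun Real.exp_eq_exp_ℝ r, ← Real.exp_add, neg_add_cancel, Real.exp_zero] at h
  simpa only [mul_div_assoc] using h

/-- A Poisson distribution has a finite mean. -/
theorem summable_poisson_weights_mul_id (r : ℝ) :
    Summable (fun k : ℕ => exp (-r) * r ^ k / (Nat.factorial k) * (k : ℝ)) := by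
  rw [← summable_nat_add_iff 1]
  refine ((hasSum_poisson_weights r).summable.mul_left r).congr fun k => ?_
  have hk : (k : ℝ) + 1 ≠ 0 := by positivity
  rw [Nat.factorial_succ]
  push_cast
  field_simp
  ring

/-- The function `k ↦ √(2η k(k+1))` has a finite Poisson mean. -/
theorem summable_poisson_weights_mul_sqrt {r η : ℝ} (hr : 0 ≤ r) (hη : 0 ≤ η) :
    Summable (fun k : ℕ => exp (-r) * r ^ k / (Nat.factorial k) *
      Real.sqrt (2 * η * ((k : ℝ) * ((k : ℝ) + 1)))) := by
  have hs := ((summable_poisson_weights_mul_id r).add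
    (hasSum_poisson_weights r).summable).mul_left (Real.sqrt (2 * η))
  refine Summable.of_nonneg_of_le (fun k => by positivity) (fun k => ?_) hs
  have hle : Real.sqrt (2 * η * ((k : ℝ) * ((k : ℝ) + 1))) ≤
      Real.sqrt (2 * η) * ((k : ℝ) + 1) := by
    rw [Real.sqrt_mul (by positivity)]
    gcongr
    rw [Real.sqrt_le_left (by positivity)]
    nlinarith [(Nat.cast_nonneg k : (0 : ℝ) ≤ k)]
  calc _ ≤ exp (-r) * r ^ k / (Nat.factorial k) * (Real.sqrt (2 * η) * ((k : ℝ) + 1)) := by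
        gcongr
    _ = _ := by ring

/-- The infimum over speeds `a > 0` of `q / (2a) + ηa` is `√(2ηq)`. -/
theorem isGLB_div_add_mul {η q : ℝ} (hη : 0 < η) (hq : 0 ≤ q) :
    IsGLB ((fun a : ℝ => q / (2 * a) + η * a) '' Set.Ioi 0) (Real.sqrt (2 * η * q)) := by
  have hsq : Real.sqrt (2 * η * q) ^ 2 = 2 * η * q := Real.sq_sqrt (by positivity)
  have hs0 : 0 ≤ Real.sqrt (2 * η * q) := Real.sqrt_nonneg _
  generalize Real.sqrt (2 * η * q) = s at hsq hs0
  constructor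
  · rintro _ ⟨a, ha, rfl⟩
    have ha : 0 < a := ha
    have key : q / (2 * a) + η * a - s = (s - 2 * η * a) ^ 2 / (4 * η * a) := by
      field_simp
      linear_combination (-2 : ℝ) * hsq
    have : 0 ≤ (s - 2 * η * a) ^ 2 / (4 * η * a) := by positivity
    change s ≤ q / (2 * a) + η * a
    linarith
  · intro b hb
    refine le_of_forall_pos_le_add fun ε hε => ?_
    have hpos : 0 < s + ε := by positivity
    have ha : 0 < (s + ε) / (2 * η) := by positivity
    refine (hb ⟨_, ha, rfl⟩).trans ?_
    have key : s + ε - (q / (2 * ((s + ε) / (2 * η))) + η * ((s + ε) / (2 * η))) =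
        ε * (2 * s + ε) / (2 * (s + ε)) := by
      field_simp
      linear_combination hsq
    have : 0 ≤ ε * (2 * s + ε) / (2 * (s + ε)) := by positivity
    change q / (2 * ((s + ε) / (2 * η))) + η * ((s + ε) / (2 * η)) ≤ s + ε
    linarith

/-- The infimum of `f a + h b` over a product set is the sum of the infima. -/
theorem isGLB_image_prod_add {α γ : Type*} {s : Set α} {t : Set γ} {f : α → ℝ} {h : γ → ℝ}
    {A B : ℝ} (hA : IsGLB (f '' s) A) (hB : IsGLB (h '' t) B) :
    IsGLB ((fun p : α × γ => f p.1 + h p.2) '' (s ×ˢ t)) (A + B) := by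
  constructor
  · rintro _ ⟨⟨a, b⟩, ⟨ha, hb⟩, rfl⟩
    exact add_le_add (hA.1 ⟨a, ha, rfl⟩) (hB.1 ⟨b, hb, rfl⟩)
  · intro c hc
    have h1 : c - B ≤ A := by
      refine hA.2 ?_
      rintro _ ⟨a, ha, rfl⟩
      have h2 : c - f a ≤ B := by
        refine hB.2 ?_
        rintro _ ⟨b, hb, rfl⟩
        have h3 : c ≤ f a + h b := hc ⟨(a, b), ⟨ha, hb⟩, rfl⟩
        linarith
      linarith
    linarith

/-- **Dynamic programming equation for the gated queueing system.**
With arrival rate `λ > 0`, linear server-speed cost coefficient `η > 0`, discount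
factor `0 < β < 1`, minimum observation gap `T̲ > 0` and an observation cost `g`
bounded on `[T̲, ∞)`, let `m T = λT²/2 + g T + β^T ∑_k e^{−λT} (λT)^k/k! √(2η k(k+1))`
and suppose `c*` satisfies `c* = inf_{T ≥ T̲} (m T + β^T c*)`.  Then
`v(x) = √(2η x(x+1)) + c*` solves the dynamic programming equation
`v(x) = inf_{a > 0, T ≥ T̲} { x(x+1)/(2a) + ηa + λT²/2 + β^T ∑_k e^{−λT}(λT)^k/k! v(k) + g T }`. -/
theorem gated_queue_dp_equation
    (lam η β Tmin : ℝ) (hlam : 0 < lam) (hη : 0 < η)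
    (hβ0 : 0 < β) (hβ1 : β < 1) (hT : 0 < Tmin)
    (g : ℝ → ℝ) (hg : ∃ C : ℝ, ∀ T ≥ Tmin, |g T| ≤ C)
    (m : ℝ → ℝ)
    (hm : ∀ T : ℝ, m T = lam * T ^ 2 / 2 + g T +
        β ^ T * ∑' k : ℕ, exp (-(lam * T)) * (lam * T) ^ k / (Nat.factorial k) *
          Real.sqrt (2 * η * ((k : ℝ) * ((k : ℝ) + 1))))
    (cstar : ℝ)
    (hc : cstar = sInf ((fun T => m T + β ^ T * cstar) '' Set.Ici Tmin))
    (v : ℕ → ℝ)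
    (hv : ∀ x : ℕ, v x = Real.sqrt (2 * η * ((x : ℝ) * ((x : ℝ) + 1))) + cstar) :
    ∀ x : ℕ,
      v x = sInf ((fun p : ℝ × ℝ =>
          (x : ℝ) * ((x : ℝ) + 1) / (2 * p.1) + η * p.1 + lam * p.2 ^ 2 / 2 +
            β ^ p.2 * (∑' k : ℕ,
              exp (-(lam * p.2)) * (lam * p.2) ^ k / (Nat.factorial k) * v k) +
            g p.2) '' (Set.Ioi 0 ×ˢ Set.Ici Tmin)) := by
  intro x
  obtain ⟨C, hC⟩ := hg
  have hbdd : BddBelow ((fun T => m T + β ^ T * cstar) '' Set.Ici Tmin) := by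
    refine ⟨-C - |cstar|, ?_⟩
    rintro _ ⟨T, hT', rfl⟩
    have hT' : Tmin ≤ T := hT'
    have hT0 : 0 < T := hT.trans_le hT'
    have hg' := (abs_le.1 (hC T hT')).1
    have hβ : 0 < β ^ T := Real.rpow_pos_of_pos hβ0 T
    have hβ' : β ^ T ≤ 1 := Real.rpow_le_one hβ0.le hβ1.le hT0.le
    have hsum : 0 ≤ β ^ T * ∑' k : ℕ, exp (-(lam * T)) * (lam * T) ^ k / (Nat.factorial k) *
        Real.sqrt (2 * η * ((k : ℝ) * ((k : ℝ) + 1))) :=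
      mul_nonneg hβ.le (tsum_nonneg fun k => by positivity)
    have hq : 0 ≤ lam * T ^ 2 / 2 := by positivity
    have hcs : -|cstar| ≤ β ^ T * cstar := by
      nlinarith [neg_abs_le cstar, abs_nonneg cstar]
    change -C - |cstar| ≤ m T + β ^ T * cstar
    rw [hm]
    linarith
  have hB : IsGLB ((fun T => m T + β ^ T * cstar) '' Set.Ici Tmin) cstar := by
    have h := isGLB_csInf (Set.nonempty_Ici.image _) hbdd
    rwa [← hc] at h
  have hA := isGLB_div_add_mul hη (q := (x : ℝ) * ((x : ℝ) + 1)) (by positivity)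
  rw [hv x, ← (isGLB_image_prod_add hA hB).csInf_eq
    ((Set.nonempty_Ioi.prod Set.nonempty_Ici).image _)]
  congr 1
  refine Set.image_congr ?_
  rintro ⟨a, T⟩ ⟨-, hT'⟩
  have hT0 : 0 ≤ lam * T := mul_nonneg hlam.le (hT.le.trans hT')
  have hsum : (∑' k : ℕ, exp (-(lam * T)) * (lam * T) ^ k / (Nat.factorial k) * v k) =
      (∑' k : ℕ, exp (-(lam * T)) * (lam * T) ^ k / (Nat.factorial k) *
        Real.sqrt (2 * η * ((k : ℝ) * ((k : ℝ) + 1)))) + cstar := by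
    have hw := (hasSum_poisson_weights (lam * T)).mul_right cstar
    rw [one_mul] at hw
    simp only [hv, mul_add (_ / _ : ℝ) (Real.sqrt _)]
    exact ((summable_poisson_weights_mul_sqrt hT0 hη.le).hasSum.add hw).tsum_eq
  simp only [hm, hsum]
  ring
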